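/- Let N ≥ 2 be an integer and let γ = [[a,b],[c,d]] ∈ SL₂(ℤ). If there exists a nonzero complex number ε such that E₂^{(N)}((aτ+b)/(cτ+d)) = ε (cτ+d)² · E₂^{(N)}(τ) for all τ in the complex upper half-plane, then c ≡ 0 (mod N), i.e. γ ∈ Γ₀(N). -/

import Mathlib

open Complex UpperHalfPlane Matrix MatrixGroups Filter

/-- `q = e^{2πiτ}`. -/
noncomputable def qExp (τ : ℂ) : ℂ := Complex.exp (2 * Real.pi * Complex.I * τ)

/-- `σ_k(n) = Σ_{d ∣ n} d^k`. -/
def sigma' (k n : ℕ) : ℕ := ∑ d ∈ n.divisors, d ^ k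

/-- Normalized Eisenstein series `E₄(τ) = 1 + 240 Σ_{n≥1} σ₃(n) qⁿ`. -/
noncomputable def E4 (τ : ℂ) : ℂ := 1 + 240 * ∑' n : ℕ+, (sigma' 3 n : ℂ) * qExp τ ^ (n : ℕ)

/-- Normalized Eisenstein series `E₆(τ) = 1 − 504 Σ_{n≥1} σ₅(n) qⁿ`. -/
noncomputable def E6 (τ : ℂ) : ℂ := 1 - 504 * ∑' n : ℕ+, (sigma' 5 n : ℂ) * qExp τ ^ (n : ℕ)

/-- Normalized weight-2 Eisenstein series `E₂(τ) = 1 − 24 Σ_{n≥1} σ₁(n) qⁿ`. -/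
noncomputable def E2 (τ : ℂ) : ℂ := 1 - 24 * ∑' n : ℕ+, (sigma' 1 n : ℂ) * qExp τ ^ (n : ℕ)

/-- `E₂^{(N)}(τ) = (N−1)/24 + Σ_{n≥1} σ₁(n)(qⁿ − N q^{Nn})`. -/
noncomputable def E2N (N : ℕ) (τ : ℂ) : ℂ :=
  ((N : ℂ) - 1) / 24 +
    ∑' n : ℕ+, (sigma' 1 n : ℂ) * (qExp τ ^ (n : ℕ) - (N : ℂ) * qExp τ ^ (N * (n : ℕ)))

/-- `a₄(τ) = −E₄(τ)/(48 E₂^{(N)}(τ)²)`. -/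
noncomputable def a4 (N : ℕ) (τ : ℂ) : ℂ := -E4 τ / (48 * E2N N τ ^ 2)

/-- `a₆(τ) = E₆(τ)/(864 E₂^{(N)}(τ)³)`. -/
noncomputable def a6 (N : ℕ) (τ : ℂ) : ℂ := E6 τ / (864 * E2N N τ ^ 3)

/-- `a₄′(τ) = −E₄(Nτ)/(48 E₂^{(N)}(τ)²)`. -/
noncomputable def a4' (N : ℕ) (τ : ℂ) : ℂ := -E4 ((N : ℂ) * τ) / (48 * E2N N τ ^ 2)

/-- `a₆′(τ) = E₆(Nτ)/(864 E₂^{(N)}(τ)³)`. -/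
noncomputable def a6' (N : ℕ) (τ : ℂ) : ℂ := E6 ((N : ℂ) * τ) / (864 * E2N N τ ^ 3)

/-- `F(q) = Σ σ₁(n+1) qⁿ`. -/
noncomputable def FF (q : ℂ) : ℂ := ∑' n : ℕ, (sigma' 1 (n + 1) : ℂ) * q ^ n

lemma sigma'_le (n : ℕ) : sigma' 1 n ≤ n ^ 2 := by
  have := ArithmeticFunction.sigma_le_pow_succ 1 n
  rwa [ArithmeticFunction.sigma_apply] at this

lemma summable_sig {q : ℂ} (hq : ‖q‖ < 1) :
    Summable fun n : ℕ ↦ (sigma' 1 n : ℂ) * q ^ n := by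
  have h := summable_pow_mul_geometric_of_norm_lt_one (R := ℝ) 2 (r := ‖q‖) (by simpa using hq)
  refine Summable.of_norm_bounded h fun n ↦ ?_
  rw [norm_mul, norm_pow, Complex.norm_natCast]
  gcongr
  exact_mod_cast sigma'_le n

lemma summable_sig_pnat {q : ℂ} (hq : ‖q‖ < 1) :
    Summable fun n : ℕ+ ↦ (sigma' 1 n : ℂ) * q ^ (n : ℕ) :=
  (summable_sig hq).comp_injective PNat.coe_injective

lemma FF_tendsto : Tendsto FF (nhds 0) (nhds 1) := by
  have h1 : (1 : ℂ) = ∑' n : ℕ, (sigma' 1 (n + 1) : ℂ) * (0 : ℂ) ^ n := by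
    rw [tsum_eq_single 0]
    · simp [sigma']
    · intro n hn; simp [hn]
  rw [h1]
  unfold FF
  have hs : Summable fun n : ℕ ↦ ((n + 1 : ℕ) : ℝ) ^ 2 * (1 / 2 : ℝ) ^ n := by
    have h := summable_pow_mul_geometric_of_norm_lt_one (R := ℝ) 2 (r := 1 / 2) (by norm_num)
    have h2 := ((summable_nat_add_iff 1).2 h).mul_left 2
    refine h2.congr fun n ↦ ?_
    rw [pow_succ]; push_cast; ring
  refine tendsto_tsum_of_dominated_convergence hs (fun n ↦ ?_) ?_
  · exact ((continuous_const.mul (continuous_pow n)).tendsto 0)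
  · have : ∀ᶠ q : ℂ in nhds 0, ‖q‖ < 1 / 2 := by
      have := Metric.ball_mem_nhds (0 : ℂ) (show (0 : ℝ) < 1 / 2 by norm_num)
      filter_upwards [this] with q hq
      simpa using hq
    filter_upwards [this] with q hq n
    rw [norm_mul, norm_pow, Complex.norm_natCast]
    gcongr
    exact_mod_cast sigma'_le (n + 1)

lemma E2_eq_FF (τ : ℂ) : E2 τ = 1 - 24 * (qExp τ * FF (qExp τ)) := by
  unfold E2 FF
  rw [tsum_pnat_eq_tsum_succ (f := fun n ↦ (sigma' 1 n : ℂ) * qExp τ ^ n), ← tsum_mul_left (a := qExp τ)]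
  congr 2
  refine tsum_congr fun n ↦ ?_
  rw [pow_succ]; ring

lemma asym (r : ℝ) (hr : 0 < r) (N : ℕ) (hN : 2 ≤ N) (u ε : ℂ) (hu : u ≠ 0) (hε : ε ≠ 0)
    (H : ∀ x : ℝ, 0 < x → x < 1 →
      (r : ℂ) * (1 - 24 * ((u * (x ^ r : ℝ)) * FF (u * (x ^ r : ℝ)))) - (1 - 24 * (x * FF x)) =
      ε * (N * (1 - 24 * ((x : ℂ) ^ N * FF ((x : ℂ) ^ N))) - (1 - 24 * (x * FF x)))) :
    r = N := by
  have hpow : ∀ s : ℝ, 0 < s →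
      Tendsto (fun x : ℝ ↦ ((x ^ s : ℝ) : ℂ)) (nhdsWithin 0 (Set.Ioi 0)) (nhds 0) := by
    intro s hs
    have h := (Real.continuousAt_rpow_const 0 s (Or.inr hs.le)).tendsto
    rw [Real.zero_rpow hs.ne'] at h
    have := (Complex.continuous_ofReal.tendsto 0).comp (h.mono_left
      (nhdsWithin_le_nhds (s := Set.Ioi 0)))
    simpa [Function.comp_def] using this
  have hX : Tendsto (fun x : ℝ ↦ (x : ℂ)) (nhdsWithin 0 (Set.Ioi 0)) (nhds 0) := by
    simpa using hpow 1 one_pos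
  have hXN : Tendsto (fun x : ℝ ↦ (x : ℂ) ^ N) (nhdsWithin 0 (Set.Ioi 0)) (nhds 0) := by
    have := hX.pow N
    rwa [zero_pow (by omega)] at this
  have hU : Tendsto (fun x : ℝ ↦ u * ((x ^ r : ℝ) : ℂ)) (nhdsWithin 0 (Set.Ioi 0)) (nhds 0) := by
    simpa using (hpow r hr).const_mul u
  have hFX := FF_tendsto.comp hX
  have hFXN := FF_tendsto.comp hXN
  have hFU := FF_tendsto.comp hU
  have hmem : ∀ᶠ x : ℝ in nhdsWithin 0 (Set.Ioi 0), 0 < x ∧ x < 1 :=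
    Ioo_mem_nhdsGT one_pos
  have hNr : (2 : ℝ) ≤ N := by exact_mod_cast hN
  have hN1 : (N : ℂ) - 1 ≠ 0 := by
    intro h
    have : (N : ℂ) = 1 := by linear_combination h
    have : N = 1 := by exact_mod_cast this
    omega
  -- the constant terms
  have e0 : (r : ℂ) - 1 = ε * (N - 1) := by
    have L := ((((hU.mul hFU).const_mul 24).const_sub 1).const_mul (r : ℂ)).sub
      (((hX.mul hFX).const_mul 24).const_sub 1)
    have R := (((((hXN.mul hFXN).const_mul 24).const_sub 1).const_mul (N : ℂ)).sub
      (((hX.mul hFX).const_mul 24).const_sub 1)).const_mul ε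
    have := tendsto_nhds_unique_of_eventuallyEq L R (by
      filter_upwards [hmem] with x hx
      exact H x hx.1 hx.2)
    simpa using this
  have H2 : ∀ x : ℝ, 0 < x → x < 1 →
      (r : ℂ) * ((u * (x ^ r : ℝ)) * FF (u * (x ^ r : ℝ))) - (x * FF x) =
      ε * (N * ((x : ℂ) ^ N * FF ((x : ℂ) ^ N)) - (x * FF x)) := by
    intro x h0 h1
    linear_combination (-1 / 24) * H x h0 h1 + (1 / 24) * e0
  rcases lt_trichotomy r 1 with h | h | h
  · exfalso
    have h1 := hpow (1 - r) (by linarith)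
    have h2 := hpow (N - r) (by linarith)
    have L := (hFU.const_mul ((r : ℂ) * u))
    have R := (h1.mul hFX).add (((h2.mul hFXN).const_mul (N : ℂ)).sub (h1.mul hFX) |>.const_mul ε)
    have := tendsto_nhds_unique_of_eventuallyEq L R (by
      filter_upwards [hmem] with x hx
      have hx0 := hx.1
      have hp : ((x ^ r : ℝ) : ℂ) ≠ 0 := by
        exact_mod_cast (Real.rpow_pos_of_pos hx0 r).ne'
      have a1 : ((x ^ (1 - r) : ℝ) : ℂ) * ((x ^ r : ℝ) : ℂ) = x := by
        rw [← Complex.ofReal_mul, ← Real.rpow_add hx0]; simp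
      have a2 : ((x ^ (N - r) : ℝ) : ℂ) * ((x ^ r : ℝ) : ℂ) = (x : ℂ) ^ N := by
        rw [← Complex.ofReal_mul, ← Real.rpow_add hx0]; simp
      have := H2 x hx.1 hx.2
      simp only [Function.comp]
      apply mul_right_cancel₀ hp
      linear_combination this - (1 - ε) * FF x * a1 - ε * N * FF ((x : ℂ) ^ N) * a2)
    simp [hu, hr.ne'] at this
  · exfalso
    rw [h] at e0
    simp [hε, hN1] at e0
  · have h1 := hpow (r - 1) (by linarith)
    have h2 := hpow (N - 1) (by linarith)
    have L := ((h1.mul hFU).const_mul ((r : ℂ) * u)).sub hFX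
    have R := (((h2.mul hFXN).const_mul (N : ℂ)).sub hFX |>.const_mul ε)
    have := tendsto_nhds_unique_of_eventuallyEq L R (by
      filter_upwards [hmem] with x hx
      have hx0 := hx.1
      have hp : (x : ℂ) ≠ 0 := by
        exact_mod_cast hx0.ne'
      have a1 : ((x ^ (r - 1) : ℝ) : ℂ) * (x : ℂ) = ((x ^ r : ℝ) : ℂ) := by
        rw [← Complex.ofReal_mul, ← Real.rpow_add_one hx0.ne']; simp
      have a2 : ((x ^ ((N : ℝ) - 1) : ℝ) : ℂ) * (x : ℂ) = (x : ℂ) ^ N := by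
        rw [← Complex.ofReal_mul, ← Real.rpow_add_one hx0.ne']; simp
      have := H2 x hx.1 hx.2
      simp only [Function.comp]
      apply mul_right_cancel₀ hp
      linear_combination this + r * u * FF (u * (x ^ r : ℝ)) * a1
        - ε * N * FF ((x : ℂ) ^ N) * a2)
    have h1 : ε = 1 := by simpa using this.symm
    rw [h1] at e0
    have : (r : ℂ) = ((N : ℝ) : ℂ) := by push_cast; linear_combination e0
    exact_mod_cast this

lemma qExp_norm {τ : ℂ} (h : 0 < τ.im) : ‖qExp τ‖ < 1 := by
  simpa [qExp] using UpperHalfPlane.norm_exp_two_pi_I_lt_one ⟨τ, h⟩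

lemma qExp_nat_mul (N : ℕ) (τ : ℂ) : qExp (N * τ) = qExp τ ^ N := by
  unfold qExp
  rw [← Complex.exp_nat_mul]; congr 1; ring

lemma E2N_eq (N : ℕ) (hN : 2 ≤ N) {τ : ℂ} (h : 0 < τ.im) :
    24 * E2N N τ = N * E2 (N * τ) - E2 τ := by
  have hq := qExp_norm h
  have hqN : ‖qExp τ ^ N‖ < 1 := by
    rw [norm_pow]; exact pow_lt_one₀ (norm_nonneg _) hq (by omega)
  unfold E2N E2
  rw [qExp_nat_mul]
  have : ∑' n : ℕ+, (sigma' 1 n : ℂ) * (qExp τ ^ (n : ℕ) - (N : ℂ) * qExp τ ^ (N * (n : ℕ))) =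
      ∑' n : ℕ+, (sigma' 1 n : ℂ) * qExp τ ^ (n : ℕ) -
        N * ∑' n : ℕ+, (sigma' 1 n : ℂ) * (qExp τ ^ N) ^ (n : ℕ) := by
    rw [← tsum_mul_left, ← (summable_sig_pnat hq).tsum_sub ((summable_sig_pnat hqN).mul_left _)]
    refine tsum_congr fun n ↦ ?_
    rw [pow_mul]; ring
  rw [this]; ring

lemma E2_coe (z : ℍ) : E2 z = EisensteinSeries.E2 z := by
  rw [EisensteinSeries.E2_eq_tsum_cexp]
  simp [E2, qExp, sigma', ArithmeticFunction.sigma_apply]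

lemma E2_trans (γ : SL(2, ℤ)) (z : ℂ) (hz : 0 < z.im) :
    0 < ((γ 0 0 * z + γ 0 1) / (γ 1 0 * z + γ 1 1) : ℂ).im ∧ (γ 1 0 * z + γ 1 1 : ℂ) ≠ 0 ∧
    E2 ((γ 0 0 * z + γ 0 1) / (γ 1 0 * z + γ 1 1)) = (γ 1 0 * z + γ 1 1) ^ 2 * E2 z -
      (1 / (2 * riemannZeta 2)) * (2 * Real.pi * Complex.I) * γ 1 0 * (γ 1 0 * z + γ 1 1) := by
  let w : ℍ := ⟨z, hz⟩
  have hw : (w : ℂ) = z := rfl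
  have hc : ((γ • w : ℍ) : ℂ) = (γ 0 0 * z + γ 0 1) / (γ 1 0 * z + γ 1 1) := by
    rw [UpperHalfPlane.coe_specialLinearGroup_apply]; simp [hw]
  have hd : UpperHalfPlane.denom γ w = γ 1 0 * z + γ 1 1 := by
    simp [UpperHalfPlane.denom, hw]
  have hne : (γ 1 0 * z + γ 1 1 : ℂ) ≠ 0 := by
    rw [← hd]; exact UpperHalfPlane.denom_ne_zero _ w
  refine ⟨by rw [← hc]; exact (γ • w).im_pos, hne, ?_⟩
  have h := congrFun (EisensteinSeries.E2_slash_action γ) w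
  rw [ModularForm.SL_slash_apply] at h
  simp only [Pi.sub_apply, Pi.smul_apply, EisensteinSeries.D2, smul_eq_mul] at h
  rw [hd, ← E2_coe, ← E2_coe, hc, hw] at h
  rw [show (-2 : ℤ) = -((2 : ℕ) : ℤ) by norm_num, _root_.zpow_neg, zpow_natCast] at h
  rw [← div_eq_mul_inv, div_eq_iff (pow_ne_zero 2 hne)] at h
  rw [h]
  field_simp

/-- If `E₂^{(N)}` transforms as a modular form of weight `2` (up to a nonzero constant)
under some `γ ∈ SL(2, ℤ)`, then `γ ∈ Γ₀(N)`. -/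
theorem mem_Gamma0_of_E2N_weight_two (N : ℕ) (hN : 2 ≤ N) (γ : SL(2, ℤ)) (ε : ℂ)
    (hε : ε ≠ 0)
    (h : ∀ τ : ℍ,
      E2N N ((((γ 0 0 : ℤ) : ℂ) * τ + ((γ 0 1 : ℤ) : ℂ)) /
             (((γ 1 0 : ℤ) : ℂ) * τ + ((γ 1 1 : ℤ) : ℂ))) =
        ε * (((γ 1 0 : ℤ) : ℂ) * τ + ((γ 1 1 : ℤ) : ℂ)) ^ 2 * E2N N (τ : ℂ)) :
    γ ∈ CongruenceSubgroup.Gamma0 N := by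
  rw [CongruenceSubgroup.Gamma0_mem, ZMod.intCast_zmod_eq_zero_iff_dvd]
  have htr := E2_trans γ
  have hdet : γ 0 0 * γ 1 1 - γ 0 1 * γ 1 0 = 1 := by
    have := γ.det_coe
    rwa [Matrix.det_fin_two] at this
  generalize γ 0 0 = a at *
  generalize γ 0 1 = b at *
  generalize γ 1 0 = c at *
  generalize γ 1 1 = d at *
  obtain ⟨g, C, M, hg, hCM, hc, hM⟩ : ∃ g C M : ℤ, 0 < g ∧ IsCoprime C M ∧ c = C * g ∧
      (N : ℤ) = M * g := by
    have hpos : 0 < Int.gcd c N := Int.gcd_pos_of_ne_zero_right _ (by omega)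
    obtain ⟨C, M, h1, h2, h3⟩ := Int.exists_gcd_one hpos
    exact ⟨_, C, M, by exact_mod_cast hpos, Int.isCoprime_iff_gcd_eq_one.2 h1, h2, h3⟩
  have hMpos : 0 < M := by
    by_contra hcon
    have : M * g ≤ 0 := mul_nonpos_of_nonpos_of_nonneg (by omega) hg.le
    omega
  have hCa : IsCoprime C a := ⟨-b * g, d, by linear_combination hdet + b * hc⟩
  obtain ⟨B', D, hBD⟩ : IsCoprime C (M * a) := hCM.mul_right hCa
  let γ' : SL(2, ℤ) := ⟨!![M * a, -B'; C, D], by rw [Matrix.det_fin_two_of]; linarith⟩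
  have htr' := E2_trans γ'
  have e00 : γ' 0 0 = M * a := rfl
  have e01 : γ' 0 1 = -B' := rfl
  have e10 : γ' 1 0 = C := rfl
  have e11 : γ' 1 1 = D := rfl
  rw [e00, e01, e10, e11] at htr'
  clear_value γ'
  obtain ⟨t, ht⟩ : ∃ t, t = D * N * b + B' * d := ⟨_, rfl⟩
  have hMR : (0 : ℝ) < M := by exact_mod_cast hMpos
  have hgR : (0 : ℝ) < g := by exact_mod_cast hg
  have hMC : (M : ℂ) ≠ 0 := by exact_mod_cast hMpos.ne'
  have hgC : (g : ℂ) ≠ 0 := by exact_mod_cast hg.ne'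
  have i1 : M * a * t + -B' * M = N * b := by
    rw [ht, hM]; rw [hc] at hdet
    linear_combination (M * g * b) * hBD + B' * M * hdet
  have i2 : C * t + D * M = d := by
    rw [ht, hM]; rw [hc] at hdet
    linear_combination d * hBD - D * M * hdet
  have hMc : (N : ℂ) = M * g := by exact_mod_cast hM
  have hcc : (c : ℂ) = C * g := by exact_mod_cast hc
  have i1c : (M * a * t + -B' * M : ℂ) = N * b := by exact_mod_cast i1
  have i2c : (C * t + D * M : ℂ) = d := by exact_mod_cast i2
  have key : ∀ τ : ℂ, 0 < τ.im → (g / M : ℂ) * E2 ((g * τ + t) / M) - E2 τ =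
      ε * (N * E2 (N * τ) - E2 τ) := by
    intro τ hτ
    have hw : 0 < ((g * τ + t) / M : ℂ).im := by
      have : ((g * τ + t) / M : ℂ) = ((g / M : ℝ) : ℂ) * τ + ((t / M : ℝ) : ℂ) := by
        push_cast; field_simp
      rw [this, Complex.add_im, Complex.im_ofReal_mul]
      simp only [Complex.ofReal_im, add_zero]
      positivity
    obtain ⟨p1, p2, p3⟩ := htr τ hτ
    obtain ⟨r1, r2, r3⟩ := htr' _ hw
    have hden : (C * ((g * τ + t) / M) + D : ℂ) = (c * τ + d) / M := by
      field_simp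
      linear_combination i2c - τ * hcc
    have hnum : (((M * a : ℤ) : ℂ) * ((g * τ + t) / M) + ((-B' : ℤ) : ℂ)) = N * (a * τ + b) / M := by
      push_cast
      field_simp
      linear_combination i1c - τ * a * hMc
    rw [hden, hnum, div_div_div_cancel_right₀ hMC, mul_div_assoc] at r3
    have hh := h ⟨τ, hτ⟩
    simp only at hh
    have q1 := E2N_eq N hN p1
    have q2 := E2N_eq N hN hτ
    rw [hh, r3, p3] at q1
    apply mul_left_cancel₀ (pow_ne_zero 2 p2)
    rw [← q2]
    have hx : ((c * τ + d : ℂ) ^ 2) * (ε * (24 * E2N N τ)) =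
      24 * (ε * (c * τ + d) ^ 2 * E2N N τ) := by ring
    rw [hx, q1, hMc, hcc]
    field_simp
    ring
  have hfin := asym (g / M) (by positivity) N hN (qExp (t / M)) ε (Complex.exp_ne_zero _) hε (by
    intro x hx0 hx1
    have hlog : Real.log x < 0 := Real.log_neg hx0 hx1
    have hpi := Real.pi_pos
    have hpiC : (Real.pi : ℂ) ≠ 0 := by exact_mod_cast hpi.ne'
    let τ : ℂ := ((-Real.log x / (2 * Real.pi) : ℝ) : ℂ) * Complex.I
    have hτ : 0 < τ.im := by
      simp only [τ, Complex.mul_I_im, Complex.ofReal_re]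
      exact div_pos (by linarith) (by positivity)
    have hq1 : qExp τ = x := by
      have : (x : ℂ) = Complex.exp (Real.log x : ℝ) := by
        rw [← Complex.ofReal_exp, Real.exp_log hx0]
      rw [this]; simp only [qExp, τ]
      congr 1
      push_cast
      field_simp
      linear_combination (-(Real.log x : ℂ)) * Complex.I_sq
    have hq2 : qExp ((g * τ + t) / M) = qExp (t / M) * ((x ^ (g / M : ℝ) : ℝ) : ℂ) := by
      rw [Real.rpow_def_of_pos hx0]
      simp only [qExp, τ]
      rw [Complex.ofReal_exp, ← Complex.exp_add]
      congr 1
      push_cast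
      field_simp
      linear_combination (-(Real.log x : ℂ) * g) * Complex.I_sq
    have := key τ hτ
    rw [E2_eq_FF, E2_eq_FF, E2_eq_FF, qExp_nat_mul, hq1, hq2] at this
    push_cast at this ⊢
    exact this)
  have hM2 : M * M = 1 := by
    rw [div_eq_iff hMR.ne'] at hfin
    have h1 : g = N * M := by exact_mod_cast hfin
    rw [hM] at h1
    have : g * (M * M) = g * 1 := by linarith
    exact mul_left_cancel₀ hg.ne' this
  have hM1 : M = 1 := by nlinarith
  rw [hM, hc, hM1, one_mul]
  exact Dvd.intro_left C rfl
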